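/- The operator Z acts tridiagonally on the rational functions of Hahn type: for every integer n with 1 ≤ n ≤ N − 1 and every integer x, −U_n(x;α,β,N) + (x/(x−α)) U_n(x−1;α,β,N) = μ₇ U_{n+1}(x;α,β,N) + μ₈ U_n(x;α,β,N) + μ₉ U_{n−1}(x;α,β,N), where μ₇ = −(β+n+1)(N−β−n)/((N−β−2n)(N−β−2n−1)), μ₈ = ((n+1)β + (n+1)²)/(N−β−2n−1) − (βn + n²)/(N−β−2n+1), and μ₉ = −n(N−n+1)/((N−β−2n)(N−β−2n+1)). -/

import Mathlib

/-- Pochhammer symbol `(a)_k = a (a+1) ⋯ (a+k-1)`, with `(a)_0 = 1`. -/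
noncomputable def poch (a : ℝ) (k : ℕ) : ℝ := ∏ i ∈ Finset.range k, (a + (i : ℝ))

/-- The rational function of Hahn type `U_n(x;α,β,N)`. -/
noncomputable def U (α β : ℝ) (N n : ℕ) (x : ℤ) : ℝ :=
  ((-1 : ℝ) ^ n * poch (-(N : ℝ)) n / poch (β + 1) n) *
    ∑ k ∈ Finset.range (n + 1),
      poch (-(x : ℝ)) k * poch (-(n : ℝ)) k * poch (β + (n : ℝ) - (N : ℝ)) k /
        ((Nat.factorial k : ℝ) * poch (-(N : ℝ)) k * poch (α - (x : ℝ)) k)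

/-- Recurrence coefficients. -/
noncomputable def mu1 (α β : ℝ) (N n : ℕ) : ℝ :=
  (n : ℝ) * (β + (n : ℝ) + 1) * ((N : ℝ) - β - (n : ℝ)) /
    (((N : ℝ) - β - 2 * (n : ℝ)) * ((N : ℝ) - β - 2 * (n : ℝ) - 1))

noncomputable def mu2 (α β : ℝ) (N n : ℕ) : ℝ :=
  -α - (n : ℝ)
    + (β * (n : ℝ) * ((n : ℝ) - 1) + (n : ℝ) ^ 2 * ((n : ℝ) - 1)) /
        ((N : ℝ) - β - 2 * (n : ℝ) + 1)
    - (β * (n : ℝ) * ((n : ℝ) + 1) + (n : ℝ) * ((n : ℝ) + 1) ^ 2) /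
        ((N : ℝ) - β - 2 * (n : ℝ) - 1)

noncomputable def mu3 (α β : ℝ) (N n : ℕ) : ℝ :=
  (n : ℝ) * ((N : ℝ) - β - (n : ℝ)) * ((N : ℝ) - (n : ℝ) + 1) /
    (((N : ℝ) - β - 2 * (n : ℝ)) * ((N : ℝ) - β - 2 * (n : ℝ) + 1))

noncomputable def mu7 (α β : ℝ) (N n : ℕ) : ℝ :=
  -((β + (n : ℝ) + 1) * ((N : ℝ) - β - (n : ℝ))) /
    (((N : ℝ) - β - 2 * (n : ℝ)) * ((N : ℝ) - β - 2 * (n : ℝ) - 1))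

noncomputable def mu8 (α β : ℝ) (N n : ℕ) : ℝ :=
  (((n : ℝ) + 1) * β + ((n : ℝ) + 1) ^ 2) / ((N : ℝ) - β - 2 * (n : ℝ) - 1)
    - (β * (n : ℝ) + (n : ℝ) ^ 2) / ((N : ℝ) - β - 2 * (n : ℝ) + 1)

noncomputable def mu9 (α β : ℝ) (N n : ℕ) : ℝ :=
  -((n : ℝ) * ((N : ℝ) - (n : ℝ) + 1)) /
    (((N : ℝ) - β - 2 * (n : ℝ)) * ((N : ℝ) - β - 2 * (n : ℝ) + 1))

theorem poch_zero (a : ℝ) : poch a 0 = 1 := by simp [poch]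

theorem poch_succ (a : ℝ) (k : ℕ) : poch a (k + 1) = poch a k * (a + k) := by
  simp [poch, Finset.prod_range_succ]

theorem poch_succ_left (a : ℝ) (k : ℕ) : poch a (k + 1) = a * poch (a + 1) k := by
  rw [poch, Finset.prod_range_succ', poch, mul_comm]
  congr 1
  · simp
  · refine Finset.prod_congr rfl fun i _ => ?_
    push_cast
    ring

theorem poch_ne_zero {a : ℝ} {k : ℕ} (h : ∀ i < k, a + (i : ℝ) ≠ 0) : poch a k ≠ 0 :=
  Finset.prod_ne_zero_iff.2 fun i hi => h i (Finset.mem_range.1 hi)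

theorem poch_neg_natCast_eq_zero {n k : ℕ} (h : n < k) : poch (-(n : ℝ)) k = 0 :=
  Finset.prod_eq_zero (Finset.mem_range.2 h) (neg_add_cancel _)

theorem poch_neg_natCast_ne_zero {N k : ℕ} (h : k ≤ N) : poch (-(N : ℝ)) k ≠ 0 := by
  refine poch_ne_zero fun i hi => ?_
  have : (i : ℝ) < N := by exact_mod_cast hi.trans_le h
  linarith

/-- The coefficient of `(-x)_k / (α - x)_k` in `U_n(x;α,β,N)`. -/
noncomputable def hahnCoeff (β : ℝ) (N n k : ℕ) : ℝ :=
  ((-1 : ℝ) ^ n * poch (-(N : ℝ)) n / poch (β + 1) n) *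
    (poch (-(n : ℝ)) k * poch (β + (n : ℝ) - (N : ℝ)) k /
      ((Nat.factorial k : ℝ) * poch (-(N : ℝ)) k))

theorem U_eq_sum (α β : ℝ) (N n m : ℕ) (h : n < m) (x : ℤ) :
    U α β N n x = ∑ k ∈ Finset.range m,
      hahnCoeff β N n k * (poch (-(x : ℝ)) k / poch (α - (x : ℝ)) k) := by
  rw [U, Finset.mul_sum]
  have hsub : Finset.range (n + 1) ⊆ Finset.range m := Finset.range_subset_range.2 h
  rw [← Finset.sum_subset hsub]
  · refine Finset.sum_congr rfl fun k _ => ?_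
    rw [hahnCoeff, mul_assoc, div_mul_div_comm]
    ring
  · intro k _ hk
    rw [Finset.mem_range, not_lt] at hk
    simp [hahnCoeff, poch_neg_natCast_eq_zero (show n < k by omega)]

theorem shift_poch_ratio (α : ℝ) (x : ℤ) (k : ℕ) :
    (x : ℝ) / (x - α) * (poch (-((x - 1 : ℤ) : ℝ)) k / poch (α - ((x - 1 : ℤ) : ℝ)) k) =
      poch (-(x : ℝ)) (k + 1) / poch (α - (x : ℝ)) (k + 1) := by
  rw [poch_succ_left, poch_succ_left, ← div_mul_div_comm, ← neg_sub (x : ℝ) α, neg_div_neg_eq]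
  push_cast
  ring_nf

theorem add_intCast_ne_zero {β : ℝ} (hβ : ∀ m : ℤ, β ≠ (m : ℝ)) (a : ℤ) : β + a ≠ 0 := by
  intro h
  apply hβ (-a)
  push_cast
  linarith

theorem poch_add_one_ne_zero {β : ℝ} (hβ : ∀ m : ℤ, β ≠ (m : ℝ)) (n : ℕ) :
    poch (β + 1) n ≠ 0 := by
  refine poch_ne_zero fun i _ => ?_
  have := add_intCast_ne_zero hβ (i + 1)
  push_cast at this
  convert this using 1
  ring

section Recurrence

variable {β : ℝ} {N m : ℕ}

theorem hahnCoeff_zero_recurrence (α : ℝ) (hβ : ∀ m : ℤ, β ≠ (m : ℝ)) (hN : m + 2 ≤ N) :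
    -hahnCoeff β N (m + 1) 0 =
      mu7 α β N (m + 1) * hahnCoeff β N (m + 2) 0 + mu8 α β N (m + 1) * hahnCoeff β N (m + 1) 0
        + mu9 α β N (m + 1) * hahnCoeff β N m 0 := by
  have hP := poch_neg_natCast_ne_zero (show m ≤ N by omega)
  have hB := poch_add_one_ne_zero hβ m
  have hNm : (m : ℝ) + 2 ≤ N := by exact_mod_cast hN
  have d1 : β + 1 + m ≠ 0 := by
    have := add_intCast_ne_zero hβ (m + 1); push_cast at this; convert this using 1; ring
  have d2 : β + 1 + (m + 1) ≠ 0 := by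
    have := add_intCast_ne_zero hβ (m + 2); push_cast at this; convert this using 1; ring
  have d3 : (N : ℝ) - β - 2 * (m + 1) ≠ 0 := by
    have := add_intCast_ne_zero hβ (2 * (m + 1) - N); push_cast at this
    contrapose! this; linarith
  have d4 : (N : ℝ) - β - 2 * (m + 1) - 1 ≠ 0 := by
    have := add_intCast_ne_zero hβ (2 * (m + 1) + 1 - N); push_cast at this
    contrapose! this; linarith
  have d5 : (N : ℝ) - β - 2 * (m + 1) + 1 ≠ 0 := by
    have := add_intCast_ne_zero hβ (2 * (m + 1) - 1 - N); push_cast at this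
    contrapose! this; linarith
  simp only [hahnCoeff, mu7, mu8, mu9, poch_zero, poch_succ, pow_succ]
  push_cast
  generalize poch (-(N : ℝ)) m = P at *
  generalize poch (β + 1) m = B at *
  generalize hD4 : (N : ℝ) - β - 2 * (m + 1) - 1 = D4 at *
  generalize hD5 : (N : ℝ) - β - 2 * (m + 1) + 1 = D5 at *
  generalize hD3 : (N : ℝ) - β - 2 * (m + 1) = D3 at *
  generalize hD2 : β + 1 + ((m : ℝ) + 1) = D2 at *
  generalize hD1 : β + 1 + (m : ℝ) = D1 at *
  field_simp
  subst hD4 hD5 hD3 hD2 hD1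
  ring

theorem hahnCoeff_succ_recurrence (α : ℝ) (hβ : ∀ m : ℤ, β ≠ (m : ℝ)) (hN : m + 2 ≤ N)
    {j : ℕ} (hj : j ≤ m + 1) :
    hahnCoeff β N (m + 1) j - hahnCoeff β N (m + 1) (j + 1) =
      mu7 α β N (m + 1) * hahnCoeff β N (m + 2) (j + 1)
        + mu8 α β N (m + 1) * hahnCoeff β N (m + 1) (j + 1)
        + mu9 α β N (m + 1) * hahnCoeff β N m (j + 1) := by
  have hP := poch_neg_natCast_ne_zero (show m ≤ N by omega)
  have hQ := poch_neg_natCast_ne_zero (show j ≤ N by omega)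
  have hB := poch_add_one_ne_zero hβ m
  have hNm : (m : ℝ) + 2 ≤ N := by exact_mod_cast hN
  have hjN : (j : ℝ) + 1 ≤ N := by exact_mod_cast (show j + 1 ≤ N by omega)
  have d0 : -(N : ℝ) + j ≠ 0 := by linarith
  have d1 : β + 1 + m ≠ 0 := by
    have := add_intCast_ne_zero hβ (m + 1); push_cast at this; convert this using 1; ring
  have d2 : β + 1 + (m + 1) ≠ 0 := by
    have := add_intCast_ne_zero hβ (m + 2); push_cast at this; convert this using 1; ring
  have d3 : (N : ℝ) - β - 2 * (m + 1) ≠ 0 := by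
    have := add_intCast_ne_zero hβ (2 * (m + 1) - N); push_cast at this
    contrapose! this; linarith
  have d4 : (N : ℝ) - β - 2 * (m + 1) - 1 ≠ 0 := by
    have := add_intCast_ne_zero hβ (2 * (m + 1) + 1 - N); push_cast at this
    contrapose! this; linarith
  have d5 : (N : ℝ) - β - 2 * (m + 1) + 1 ≠ 0 := by
    have := add_intCast_ne_zero hβ (2 * (m + 1) - 1 - N); push_cast at this
    contrapose! this; linarith
  have d6 : β + (m + 1) - (N : ℝ) ≠ 0 := by
    have := add_intCast_ne_zero hβ (m + 1 - N); push_cast at this; convert this using 1; ring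
  have d7 : (m : ℝ) + 1 ≠ 0 := by positivity
  have d8 : (j : ℝ) + 1 ≠ 0 := by positivity
  have d9 : (Nat.factorial j : ℝ) ≠ 0 := by positivity
  have e1 : poch (-((m : ℝ) + 1 + 1)) (j + 1) = -(m + 2) * poch (-((m : ℝ) + 1)) j := by
    rw [poch_succ_left]; ring_nf
  have e2 : poch (-(m : ℝ)) (j + 1) =
      poch (-((m : ℝ) + 1)) j * (-((m : ℝ) + 1) + j) * (j - m) / (-((m : ℝ) + 1)) := by
    rw [eq_div_iff (neg_ne_zero.2 d7), mul_comm]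
    have := poch_succ_left (-((m : ℝ) + 1)) (j + 1)
    rw [show -((m : ℝ) + 1) + 1 = -m by ring] at this
    rw [← this, poch_succ, poch_succ]
    push_cast
    ring
  have e3 : poch (β + ((m : ℝ) + 1 + 1) - N) (j + 1) =
      poch (β + ((m : ℝ) + 1) - N) j * (β + (m + 1) - N + j) * (β + (m + 1) - N + j + 1) /
        (β + (m + 1) - N) := by
    rw [eq_div_iff d6, mul_comm]
    have := poch_succ_left (β + ((m : ℝ) + 1) - N) (j + 1)
    rw [show β + ((m : ℝ) + 1) - N + 1 = β + ((m : ℝ) + 1 + 1) - N by ring] at this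
    rw [← this, poch_succ, poch_succ]
    push_cast
    ring
  have e4 : poch (β + (m : ℝ) - N) (j + 1) =
      (β + m - N) * poch (β + ((m : ℝ) + 1) - N) j := by
    rw [poch_succ_left]; ring_nf
  simp only [hahnCoeff, mu7, mu8, mu9, Nat.factorial_succ]
  push_cast
  rw [show ((m : ℝ) + 2) = m + 1 + 1 by ring, e1, e2, e3, e4]
  simp only [poch_succ, pow_succ]
  push_cast
  generalize poch (-(N : ℝ)) m = P at *
  generalize poch (-(N : ℝ)) j = Q at *
  generalize poch (β + 1) m = B at *
  generalize poch (β + ((m : ℝ) + 1) - N) j = S at *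
  generalize poch (-((m : ℝ) + 1)) j = R at *
  generalize (Nat.factorial j : ℝ) = F at *
  generalize hD4 : (N : ℝ) - β - 2 * (m + 1) - 1 = D4 at *
  generalize hD5 : (N : ℝ) - β - 2 * (m + 1) + 1 = D5 at *
  generalize hD3 : (N : ℝ) - β - 2 * (m + 1) = D3 at *
  generalize hD2 : β + 1 + ((m : ℝ) + 1) = D2 at *
  generalize hD1 : β + 1 + (m : ℝ) = D1 at *
  generalize hD6 : β + ((m : ℝ) + 1) - N = D6 at *
  generalize hD0 : -(N : ℝ) + j = D0 at *
  field_simp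
  subst hD4 hD5 hD3 hD2 hD1 hD6 hD0
  ring

end Recurrence

theorem statement12 (N : ℕ) (hN : 0 < N) (α β : ℝ)
    (hα : ∀ m : ℤ, α ≠ (m : ℝ)) (hβ : ∀ m : ℤ, β ≠ (m : ℝ))
    (n : ℕ) (hn1 : 1 ≤ n) (hn2 : n + 1 ≤ N) (x : ℤ) :
    -U α β N n x + ((x : ℝ) / ((x : ℝ) - α)) * U α β N n (x - 1) =
      mu7 α β N n * U α β N (n + 1) x + mu8 α β N n * U α β N n x
        + mu9 α β N n * U α β N (n - 1) x := by
  obtain ⟨m, rfl⟩ : ∃ m, n = m + 1 := ⟨n - 1, by omega⟩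
  have hshift : (x : ℝ) / (x - α) * U α β N (m + 1) (x - 1) = ∑ k ∈ Finset.range (m + 2),
      hahnCoeff β N (m + 1) k * (poch (-(x : ℝ)) (k + 1) / poch (α - (x : ℝ)) (k + 1)) := by
    rw [U_eq_sum α β N (m + 1) (m + 2) (by omega), Finset.mul_sum]
    refine Finset.sum_congr rfl fun k _ => ?_
    rw [← shift_poch_ratio, mul_left_comm]
  rw [hshift, Nat.add_sub_cancel, U_eq_sum α β N (m + 1) (m + 3) (by omega),
    U_eq_sum α β N (m + 1 + 1) (m + 3) (by omega), U_eq_sum α β N m (m + 3) (by omega)]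
  simp only [Finset.sum_range_succ' _ (m + 2), neg_add, mul_add, Finset.mul_sum]
  rw [← Finset.sum_neg_distrib]
  have hsum := Finset.sum_congr (rfl : Finset.range (m + 2) = _) fun j hj =>
    congrArg (· * (poch (-(x : ℝ)) (j + 1) / poch (α - (x : ℝ)) (j + 1)))
      (hahnCoeff_succ_recurrence α hβ hn2 (j := j) (by have := Finset.mem_range.1 hj; omega))
  simp only [sub_mul, add_mul, Finset.sum_add_distrib, Finset.sum_sub_distrib, mul_assoc] at hsum
  have hzero := hahnCoeff_zero_recurrence α hβ hn2
  simp only [Finset.sum_neg_distrib, poch_zero, div_one, mul_one]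
  linarith
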